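/- Let λ be a nonzero real number, let k ≥ 1 be an integer, and let x be a real number with |x| < 1. Then the series Σ_{n=1}^∞ ( (n)_{1,λ} + (n)_{2,λ} + ⋯ + (n)_{k,λ} ) · H_{n,λ} · x^n converges absolutely and equals (1/(1−x)) · Σ_{l=1}^k ( HF_{l,λ}(x/(1−x)) − log_λ(1−x) · F^{(1−λ)}_{l,λ}(x/(1−x)) ), where log_λ(1−x) = ((1−x)^λ − 1)/λ. -/

import Mathlib

open Finset

/-- The degenerate falling factorial `(x)_{n,λ} = x(x-λ)⋯(x-(n-1)λ)`. -/
noncomputable def degFall (lam x : ℝ) (n : ℕ) : ℝ := ∏ i ∈ Finset.range n, (x - (i : ℝ) * lam)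

/-- The ordinary falling factorial `(x)_n = x(x-1)⋯(x-n+1)`. -/
noncomputable def fall (x : ℝ) (n : ℕ) : ℝ := ∏ i ∈ Finset.range n, (x - (i : ℝ))

/-- The rising factorial `⟨a⟩_k = a(a+1)⋯(a+k-1)`. -/
noncomputable def rising (a : ℝ) (k : ℕ) : ℝ := ∏ i ∈ Finset.range k, (a + (i : ℝ))

/-- The generalized binomial coefficient `binom(a,k) = a(a-1)⋯(a-k+1)/k!`. -/
noncomputable def rchoose (a : ℝ) (k : ℕ) : ℝ :=
  (∏ i ∈ Finset.range k, (a - (i : ℝ))) / (k.factorial : ℝ)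

/-- The degenerate harmonic numbers `H_{n,λ} = Σ_{k=1}^n (1/k)·binom(k-1-λ, k-1)`. -/
noncomputable def degH (lam : ℝ) (n : ℕ) : ℝ :=
  ∑ k ∈ Finset.Icc 1 n, (1 / (k : ℝ)) * rchoose ((k : ℝ) - 1 - lam) (k - 1)

/-- The degenerate hyperharmonic numbers `H^{(r)}_{n,λ}`. -/
noncomputable def degHyperH (lam : ℝ) : ℕ → ℕ → ℝ
  | 0, _ => 0
  | 1, n => degH lam n
  | r + 2, n => ∑ k ∈ Finset.Icc 1 n, degHyperH lam (r + 1) k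

/-- The degenerate harmonic-Fubini polynomial built from degenerate Stirling numbers `S2`. -/
noncomputable def HFpoly (lam : ℝ) (S2 : ℕ → ℕ → ℝ) (n : ℕ) (x : ℝ) : ℝ :=
  ∑ k ∈ Finset.Icc 1 n, S2 n k * degH lam k * (k.factorial : ℝ) * x ^ k

/-- The degenerate Fubini polynomial of order `1-λ` built from degenerate Stirling numbers `S2`. -/
noncomputable def Fpoly (lam : ℝ) (S2 : ℕ → ℕ → ℝ) (n : ℕ) (x : ℝ) : ℝ :=
  ∑ k ∈ Finset.range (n + 1), rising (1 - lam) k * S2 n k * x ^ k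

/-- The degenerate hyperharmonic-Fubini polynomial built from degenerate Stirling numbers `S2`. -/
noncomputable def HFpolyR (lam : ℝ) (S2 : ℕ → ℕ → ℝ) (r n : ℕ) (y : ℝ) : ℝ :=
  ∑ k ∈ Finset.Icc 1 n, S2 n k * degHyperH lam r k * (k.factorial : ℝ) * y ^ k

/-- The degenerate falling factorial power of the operator `θ = x·d/dx`:
`(θ)_{k,λ} = (θ - (k-1)λ) ∘ ⋯ ∘ (θ - λ) ∘ θ`. -/
noncomputable def thetaFall (lam : ℝ) : ℕ → (ℝ → ℝ) → ℝ → ℝ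
  | 0, g => g
  | k + 1, g => fun x => x * deriv (thetaFall lam k g) x - (k : ℝ) * lam * thetaFall lam k g x

theorem rising_succ (a : ℝ) (n : ℕ) : rising a (n + 1) = rising a n * (a + n) := by
  simp [rising, Finset.prod_range_succ]

theorem rising_add (a : ℝ) (m n : ℕ) :
    rising a (m + n) = rising a n * rising (a + n) m := by
  rw [add_comm m n, rising, Finset.prod_range_add]
  simp [rising, add_assoc]

theorem rising_one (n : ℕ) : rising 1 n = n.factorial := by
  induction n with
  | zero => simp [rising]
  | succ n ih => rw [rising_succ, ih, Nat.factorial_succ]; push_cast; ring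

theorem multichoose_eq_rising_div (a : ℝ) (n : ℕ) :
    Ring.multichoose a n = rising a n / n.factorial := by
  rw [eq_div_iff (by positivity), mul_comm, ← nsmul_eq_mul,
    Ring.factorial_nsmul_multichoose_eq_ascPochhammer,
    Polynomial.ascPochhammer_smeval_eq_eval]
  induction n with
  | zero => simp [rising]
  | succ n ih => rw [rising_succ, ascPochhammer_succ_eval, ih]

theorem fall_natCast (n j : ℕ) : fall (n : ℝ) j = n.descFactorial j := by
  rw [fall, ← descPochhammer_eval_eq_prod_range, descPochhammer_eval_eq_descFactorial]

/-- The binomial series for a negated exponent. -/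
theorem hasSum_rising_div_factorial (a : ℝ) {x : ℝ} (hx : |x| < 1) :
    HasSum (fun n : ℕ => rising a n / n.factorial * x ^ n) ((1 - x) ^ (-a)) := by
  have hball : x ∈ Metric.eball (0 : ℝ) 1 := by
    simpa [Metric.mem_eball, edist_dist, Real.dist_eq] using hx
  have h := (Real.one_div_one_sub_rpow_hasFPowerSeriesOnBall_zero a).hasSum hball
  have h1 : 0 ≤ 1 - x := by linarith [(abs_lt.mp hx).2]
  have hshift (n : ℕ) : a + n - 1 - n + 1 = a := by ring
  simpa [Ring.choose, multichoose_eq_rising_div, hshift, Real.rpow_neg h1, mul_comm] using h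

theorem hasSum_fall_mul_rising (a : ℝ) (j : ℕ) {x : ℝ} (hx : |x| < 1) :
    HasSum (fun n : ℕ => fall (n : ℝ) j * (rising a n / n.factorial) * x ^ n)
      (x ^ j * rising a j * (1 - x) ^ (-(a + j))) := by
  rw [← (add_left_injective j).hasSum_iff]
  · refine ((hasSum_rising_div_factorial (a + j) hx).mul_left (x ^ j * rising a j)).congr_fun ?_
    intro m
    have hm : (m.factorial : ℝ) * (m + j).descFactorial j = (m + j).factorial := by
      have := Nat.factorial_mul_descFactorial (Nat.le_add_left j m)
      rw [Nat.add_sub_cancel] at this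
      exact_mod_cast this
    have h1 : (m.factorial : ℝ) ≠ 0 := by positivity
    have h2 : ((m + j).descFactorial j : ℝ) ≠ 0 := by
      intro h0
      rw [h0, mul_zero] at hm
      exact (Nat.cast_ne_zero.mpr (Nat.factorial_ne_zero _)) hm.symm
    simp only [Function.comp_apply]
    rw [fall_natCast, rising_add, ← hm, pow_add]
    field_simp
  · intro n hn
    have hnj : n < j := by
      by_contra! h
      exact hn ⟨n - j, Nat.sub_add_cancel h⟩
    simp [fall_natCast, Nat.descFactorial_eq_zero_iff_lt.mpr hnj]

theorem rchoose_sub_self (lam : ℝ) (n : ℕ) :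
    rchoose ((n : ℝ) - lam) n = rising (1 - lam) n / n.factorial := by
  rw [rchoose, rising, ← Finset.prod_range_reflect]
  congr 1
  refine Finset.prod_congr rfl fun i hi => ?_
  have : i + 1 ≤ n := Finset.mem_range.mp hi
  rw [Nat.sub_sub, add_comm 1 i, Nat.cast_sub this]
  push_cast
  ring

theorem degH_eq {lam : ℝ} (hlam : lam ≠ 0) (n : ℕ) :
    degH lam n = (rising 1 n / n.factorial - rising (1 - lam) n / n.factorial) / lam := by
  have hfac (n : ℕ) : (n.factorial : ℝ) ≠ 0 := by positivity
  induction n with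
  | zero => simp [degH, rising]
  | succ n ih =>
    have hn : (n : ℝ) + 1 ≠ 0 := by positivity
    have hstep : degH lam (n + 1)
        = degH lam n + 1 / ((n : ℝ) + 1) * (rising (1 - lam) n / n.factorial) := by
      rw [← rchoose_sub_self, degH, Finset.sum_Icc_succ_top (by omega), ← degH]
      simp
    rw [hstep, ih, rising_one, rising_one, rising_succ, Nat.factorial_succ]
    have := hfac n
    push_cast
    field_simp
    ring

theorem hasSum_fall_mul_degH {lam : ℝ} (hlam : lam ≠ 0) (j : ℕ) {x : ℝ} (hx : |x| < 1) :
    HasSum (fun n : ℕ => fall (n : ℝ) j * degH lam n * x ^ n)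
      (1 / (1 - x) * (degH lam j * j.factorial * (x / (1 - x)) ^ j
        - ((1 - x) ^ lam - 1) / lam * (rising (1 - lam) j * (x / (1 - x)) ^ j))) := by
  have h1 : 0 < 1 - x := by linarith [(abs_lt.mp hx).2]
  have h := ((hasSum_fall_mul_rising 1 j hx).sub
    (hasSum_fall_mul_rising (1 - lam) j hx)).div_const lam
  convert h using 1
  · rfl
  · funext n
    rw [degH_eq hlam]
    ring
  · have e1 : (1 - x) ^ (-(1 + (j : ℝ))) = ((1 - x) * (1 - x) ^ j)⁻¹ := by
      rw [Real.rpow_neg h1.le, Real.rpow_add h1, Real.rpow_one, Real.rpow_natCast]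
    have e2 : (1 - x) ^ (-(1 - lam + (j : ℝ)))
        = (1 - x) ^ lam * ((1 - x) * (1 - x) ^ j)⁻¹ := by
      rw [← e1, ← Real.rpow_add h1]
      congr 1
      ring
    have hfac : (j.factorial : ℝ) ≠ 0 := by positivity
    rw [e1, e2, degH_eq hlam, rising_one, div_pow]
    field_simp
    ring

theorem HFpoly_eq_sum_range (lam : ℝ) (S2 : ℕ → ℕ → ℝ) (l : ℕ) (y : ℝ) :
    HFpoly lam S2 l y
      = ∑ j ∈ Finset.range (l + 1), S2 l j * degH lam j * (j.factorial : ℝ) * y ^ j := by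
  rw [Finset.range_eq_Ico, Finset.sum_eq_sum_Ico_succ_bot (Nat.succ_pos l), HFpoly]
  simp [degH, Finset.Ico_add_one_right_eq_Icc]

theorem hasSum_degFall_mul_degH {lam : ℝ} (hlam : lam ≠ 0) {S2 : ℕ → ℕ → ℝ}
    (hS2 : ∀ (m : ℕ) (z : ℝ), degFall lam z m = ∑ j ∈ Finset.range (m + 1), S2 m j * fall z j)
    (l : ℕ) {x : ℝ} (hx : |x| < 1) :
    HasSum (fun n : ℕ => degFall lam (n : ℝ) l * degH lam n * x ^ n)
      (1 / (1 - x) * (HFpoly lam S2 l (x / (1 - x))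
        - (((1 - x) ^ lam - 1) / lam) * Fpoly lam S2 l (x / (1 - x)))) := by
  have h := hasSum_sum (s := Finset.range (l + 1))
    fun j _ => (hasSum_fall_mul_degH hlam j hx).mul_left (S2 l j)
  convert h using 1
  · rfl
  · funext n
    rw [hS2, Finset.sum_mul, Finset.sum_mul]
    exact Finset.sum_congr rfl fun j _ => by ring
  · rw [HFpoly_eq_sum_range, Fpoly, Finset.mul_sum, ← Finset.sum_sub_distrib, Finset.mul_sum]
    exact Finset.sum_congr rfl fun j _ => by ring


theorem stmt15 (lam : ℝ) (hlam : lam ≠ 0) (k : ℕ) (hk : 1 ≤ k) (x : ℝ) (hx : |x| < 1)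
    (S2 : ℕ → ℕ → ℝ)
    (hS2 : ∀ (m : ℕ) (z : ℝ), degFall lam z m = ∑ j ∈ Finset.range (m + 1), S2 m j * fall z j) :
    Summable (fun n : ℕ =>
      |(∑ j ∈ Finset.Icc 1 k, degFall lam (n : ℝ) j) * degH lam n * x ^ n|) ∧
    ∑' n : ℕ, (∑ j ∈ Finset.Icc 1 k, degFall lam (n : ℝ) j) * degH lam n * x ^ n
      = (1 / (1 - x)) * ∑ l ∈ Finset.Icc 1 k,
          (HFpoly lam S2 l (x / (1 - x))
            - (((1 - x) ^ lam - 1) / lam) * Fpoly lam S2 l (x / (1 - x))) := by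
  have h : HasSum (fun n : ℕ =>
      (∑ j ∈ Finset.Icc 1 k, degFall lam (n : ℝ) j) * degH lam n * x ^ n)
      ((1 / (1 - x)) * ∑ l ∈ Finset.Icc 1 k,
          (HFpoly lam S2 l (x / (1 - x))
            - (((1 - x) ^ lam - 1) / lam) * Fpoly lam S2 l (x / (1 - x)))) := by
    simp only [Finset.mul_sum, Finset.sum_mul]
    exact hasSum_sum fun l _ => hasSum_degFall_mul_degH hlam hS2 l hx
  exact ⟨h.summable.abs, h.tsum_eq⟩
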